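/- For every α ∈ (0,1), the map ℛ_α : 𝒱₁ → 𝒱₁ is continuous with respect to the weighted uniform metric d(f,g) = sup_{x∈ℝ} ρ(x)|f(x)−g(x)|; that is, for every f₀ ∈ 𝒱₁ and every ε > 0 there exists δ > 0 such that every f ∈ 𝒱₁ with sup_x ρ(x)|f(x)−f₀(x)| ≤ δ satisfies sup_x ρ(x)|ℛ_α(f)(x)−ℛ_α(f₀)(x)| ≤ ε. -/

import Mathlib

open Real MeasureTheory Set Filter BoundedContinuousFunction

noncomputable section

namespace GSQGplane

/-- The constant `c_{1,α} = 2^{2α-1} Γ(1/2+α) / (√π Γ(1-α))`. -/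
def C1 (α : ℝ) : ℝ :=
  (2:ℝ) ^ (2*α - 1) * Real.Gamma (1/2 + α) / (Real.sqrt π * Real.Gamma (1 - α))

/-- The constant `η = 2 (3/(2(3-2α)(5-2α)(1+4^α)))^{1/min(α,1-α)}`. -/
def etaC (α : ℝ) : ℝ :=
  2 * (3 / (2*(3 - 2*α)*(5 - 2*α)*(1 + (4:ℝ) ^ α))) ^ (1 / min α (1 - α))

/-- The weight `ρ(x) = (1+|x|)^{-α}`. -/
def rho (α : ℝ) (x : ℝ) : ℝ := (1 + |x|) ^ (-α)

/-- The invariant set `𝒱₁`: even continuous functions with finite weighted sup-norm,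
`f(0)=1`, nonnegative and non-increasing on `[0,∞)`, `x ↦ f(√x)` convex,
`f ≥ max(0,1-x²)`, and left derivative at `1/2` at most `-η`. -/
def V1 (α : ℝ) (f : ℝ → ℝ) : Prop :=
  Continuous f ∧ (∀ x : ℝ, f (-x) = f x) ∧ (∃ M : ℝ, ∀ x : ℝ, rho α x * |f x| ≤ M) ∧
  f 0 = 1 ∧ (∀ x ∈ Ici (0:ℝ), 0 ≤ f x) ∧ AntitoneOn f (Ici (0:ℝ)) ∧
  ConvexOn ℝ (Ici (0:ℝ)) (fun x => f (Real.sqrt x)) ∧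
  (∀ x : ℝ, max 0 (1 - x^2) ≤ f x) ∧
  (∃ d : ℝ, HasDerivWithinAt f d (Iio (1/2 : ℝ)) (1/2 : ℝ) ∧ d ≤ -(etaC α))

/-- The normalization functional `c(f)`. -/
def cV (α : ℝ) (f : ℝ → ℝ) : ℝ :=
  (2*α*(1+2*α)/3) * C1 α * ∫ ξ in Ioi (0:ℝ), (1 - f ξ) * ξ ^ (-1 - 2*α)

/-- The functional `b(f) = 2 c_{1,α} ∫₀^∞ f(ξ) ξ^{1-2α} dξ`. -/
def bV (α : ℝ) (f : ℝ → ℝ) : ℝ :=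
  2 * C1 α * ∫ ξ in Ioi (0:ℝ), f ξ * ξ ^ (1 - 2*α)

/-- The linear operator `𝒯_α(f)`, defined for `x > 0`, set to `0` at `x = 0`,
and extended evenly to `ℝ` (via `|x|`). -/
def TV (α : ℝ) (f : ℝ → ℝ) (x : ℝ) : ℝ :=
  if x = 0 then 0
  else if α = 1/2 then
    C1 α * ∫ ξ in Ioi (0:ℝ), f ξ * ((ξ / |x|) * Real.log ((|x| + ξ) / |(|x| - ξ)|) - 2)
  else
    (C1 α / (1 - 2*α)) * ∫ ξ in Ioi (0:ℝ),
      f ξ * ((ξ / |x|) * ((|x| + ξ) ^ (1 - 2*α) - |(|x| - ξ)| ^ (1 - 2*α))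
        - 2*(1 - 2*α) * ξ ^ (1 - 2*α))

/-- The nonlinear map `ℛ_α(f)(x) = max(0, 1 + 𝒯_α(f)(x)/c(f))`. -/
def RV (α : ℝ) (f : ℝ → ℝ) (x : ℝ) : ℝ := max 0 (1 + TV α f x / cV α f)

/-! ### Convexity inequalities on the half-line -/

lemma two_mul_le_add_of_hasDerivAt_monotoneOn {f f' : ℝ → ℝ}
    (hf : ∀ u, 0 < u → HasDerivAt f (f' u) u) (hf' : MonotoneOn f' (Ioi 0))
    {s t : ℝ} (ht : 0 ≤ t) (hts : t < s) : 2 * f s ≤ f (s + t) + f (s - t) := by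
  have hconv : ConvexOn ℝ (Ioi (0:ℝ)) f := by
    refine MonotoneOn.convexOn_of_deriv (convex_Ioi 0)
      (fun u hu => (hf u hu).continuousAt.continuousWithinAt) ?_ ?_
    · rw [interior_Ioi]
      exact fun u hu => (hf u hu).differentiableAt.differentiableWithinAt
    · rw [interior_Ioi]
      intro u hu v hv huv
      rw [(hf u hu).deriv, (hf v hv).deriv]
      exact hf' hu hv huv
  have h := hconv.2 (mem_Ioi.2 (by linarith : 0 < s + t)) (mem_Ioi.2 (by linarith : 0 < s - t))
    (by norm_num : (0:ℝ) ≤ 1/2) (by norm_num : (0:ℝ) ≤ 1/2) (by norm_num)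
  simp only [smul_eq_mul] at h
  rw [show (1/2:ℝ) * (s + t) + 1/2 * (s - t) = s by ring] at h
  linarith

lemma nonneg_of_hasDerivAt_nonneg {F F' : ℝ → ℝ} (hF0 : F 0 = 0)
    (hF : ∀ t ∈ Icc (0:ℝ) 1, HasDerivAt F (F' t) t) (hF' : ∀ t ∈ Icc (0:ℝ) 1, 0 ≤ F' t) :
    0 ≤ F 1 := by
  have hmono : MonotoneOn F (Icc 0 1) := by
    refine monotoneOn_of_deriv_nonneg (convex_Icc 0 1)
      (fun t ht => (hF t ht).continuousAt.continuousWithinAt) ?_ ?_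
    · exact fun t ht => (hF t (interior_subset ht)).differentiableAt.differentiableWithinAt
    · intro t ht
      rw [(hF t (interior_subset ht)).deriv]
      exact hF' t (interior_subset ht)
  have := hmono (left_mem_Icc.2 zero_le_one) (right_mem_Icc.2 zero_le_one) zero_le_one
  linarith

lemma two_mul_rpow_le {q s t : ℝ} (hq : q ≤ 0) (ht : 0 ≤ t) (hts : t < s) :
    2 * s ^ q ≤ (s + t) ^ q + (s - t) ^ q := by
  refine two_mul_le_add_of_hasDerivAt_monotoneOn (f := fun u => u ^ q)
    (f' := fun u => q * u ^ (q - 1)) (fun u hu => Real.hasDerivAt_rpow_const (Or.inl hu.ne')) ?_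
    ht hts
  intro u hu v _ huv
  exact mul_le_mul_of_nonpos_left (Real.rpow_le_rpow_of_nonpos hu huv (by linarith)) hq

/-! ### The radial kernel -/

/-- `φ`, `Φ`, `Ψ` are successive primitives of `u ↦ u ^ (p - 1)` on `(0, ∞)`, normalized so that
`Φ` vanishes at the origin and `φ`, `Φ` satisfy Euler's relation. -/
structure IsPotential (p : ℝ) (φ Φ Ψ : ℝ → ℝ) : Prop where
  hasDerivAt_fst : ∀ u, 0 < u → HasDerivAt φ (u ^ (p - 1)) u
  hasDerivAt_snd : ∀ u, 0 < u → HasDerivAt Φ (φ u) u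
  hasDerivAt_trd : ∀ u, 0 < u → HasDerivAt Ψ (Φ u) u
  continuous_snd : Continuous Φ
  continuous_trd : Continuous Ψ
  snd_zero : Φ 0 = 0
  euler : ∀ u, 0 < u → u * φ u - Φ u = u ^ (p + 1) / (p + 1)

/-- The kernel of the rescaled operator `𝒯_α`, with `p = 1 - 2α`. -/
def radialKernel (p : ℝ) (φ : ℝ → ℝ) (s : ℝ) : ℝ :=
  s * (φ (1 + s) - φ |1 - s|) - 2 * s ^ p

/-- Primitive of the radial kernel on `(0, 1)`. -/
def innerPrimitive (p : ℝ) (Φ Ψ : ℝ → ℝ) (s : ℝ) : ℝ :=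
  s * (Φ (1 + s) + Φ (1 - s)) - (Ψ (1 + s) - Ψ (1 - s)) - 2 * s ^ (p + 1) / (p + 1)

/-- Primitive of the radial kernel on `(1, ∞)`. -/
def outerPrimitive (p : ℝ) (Φ Ψ : ℝ → ℝ) (s : ℝ) : ℝ :=
  s * (Φ (s + 1) - Φ (s - 1)) - (Ψ (s + 1) - Ψ (s - 1)) - 2 * s ^ (p + 1) / (p + 1)

namespace IsPotential

variable {p : ℝ} {φ Φ Ψ : ℝ → ℝ}

lemma monotoneOn_fst (h : IsPotential p φ Φ Ψ) : MonotoneOn φ (Ioi 0) := by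
  refine monotoneOn_of_deriv_nonneg (convex_Ioi 0)
    (fun u hu => (h.hasDerivAt_fst u hu).continuousAt.continuousWithinAt) ?_ ?_
  · rw [interior_Ioi]
    exact fun u hu => (h.hasDerivAt_fst u hu).differentiableAt.differentiableWithinAt
  · rw [interior_Ioi]
    intro u hu
    rw [(h.hasDerivAt_fst u hu).deriv]
    exact Real.rpow_nonneg (le_of_lt hu) _

lemma radialKernel_nonneg_of_one_lt (h : IsPotential p φ Φ Ψ) (hp : p < 1) {s : ℝ} (hs : 1 < s) :
    0 ≤ radialKernel p φ s := by
  have key : 0 ≤ φ (s + 1) - φ (s - 1) - 2 * 1 * s ^ (p - 1) := by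
    refine nonneg_of_hasDerivAt_nonneg
      (F := fun t => φ (s + t) - φ (s - t) - 2 * t * s ^ (p - 1))
      (F' := fun t => (s + t) ^ (p - 1) - (s - t) ^ (p - 1) * (-1) - 2 * 1 * s ^ (p - 1))
      (by simp) ?_ ?_
    · rintro t ⟨h0, h1⟩
      have d1 := (h.hasDerivAt_fst (s + t) (by linarith)).comp t ((hasDerivAt_id t).const_add s)
      have d2 := (h.hasDerivAt_fst (s - t) (by linarith)).comp t ((hasDerivAt_id t).const_sub s)
      have d3 := ((hasDerivAt_id t).const_mul 2).mul_const (s ^ (p - 1))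
      refine ((d1.sub d2).sub d3).congr_deriv ?_
      ring
    · rintro t ⟨h0, h1⟩
      have := two_mul_rpow_le (q := p - 1) (s := s) (by linarith) h0 (by linarith)
      linarith
  have hpow : s * s ^ (p - 1) = s ^ p := by
    rw [mul_comm, ← Real.rpow_add_one (by linarith : s ≠ 0)]; ring_nf
  rw [radialKernel, abs_sub_comm, abs_of_pos (by linarith : (0:ℝ) < s - 1), add_comm 1 s, ← hpow]
  nlinarith

lemma outerPrimitive_nonpos (h : IsPotential p φ Φ Ψ) (hp : p < 1) {s : ℝ} (hs : 1 < s) :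
    outerPrimitive p Φ Ψ s ≤ 0 := by
  have key : 0 ≤ -(s * (Φ (s + 1) - Φ (s - 1)) - (Ψ (s + 1) - Ψ (s - 1))
      - 1 * (2 * s ^ (p + 1) / (p + 1))) := by
    refine nonneg_of_hasDerivAt_nonneg
      (F := fun t => -(s * (Φ (s + t) - Φ (s - t)) - (Ψ (s + t) - Ψ (s - t))
        - t * (2 * s ^ (p + 1) / (p + 1))))
      (F' := fun t => -(s * (φ (s + t) + φ (s - t)) - (Φ (s + t) + Φ (s - t))
        - 2 * s ^ (p + 1) / (p + 1)))
      (by simp) ?_ ?_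
    · rintro t ⟨h0, h1⟩
      have a1 := (hasDerivAt_id t).const_add s
      have a2 := (hasDerivAt_id t).const_sub s
      have d1 := (h.hasDerivAt_snd (s + t) (by linarith)).comp t a1
      have d2 := (h.hasDerivAt_snd (s - t) (by linarith)).comp t a2
      have e1 := (h.hasDerivAt_trd (s + t) (by linarith)).comp t a1
      have e2 := (h.hasDerivAt_trd (s - t) (by linarith)).comp t a2
      have d3 := (hasDerivAt_id t).mul_const (2 * s ^ (p + 1) / (p + 1))
      refine ((((d1.sub d2).const_mul s).sub (e1.sub e2)).sub d3).neg.congr_deriv ?_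
      ring
    · rintro t ⟨h0, h1⟩
      have c1 := two_mul_le_add_of_hasDerivAt_monotoneOn (f := fun u => -φ u)
        (f' := fun u => -u ^ (p - 1)) (fun u hu => (h.hasDerivAt_fst u hu).neg)
        (fun u hu v _ huv => neg_le_neg (Real.rpow_le_rpow_of_nonpos hu huv (by linarith)))
        h0 (by linarith : t < s)
      have c2 := two_mul_le_add_of_hasDerivAt_monotoneOn h.hasDerivAt_snd h.monotoneOn_fst
        h0 (by linarith : t < s)
      have c3 := h.euler s (by linarith)
      have c4 : 2 * s ^ (p + 1) / (p + 1) = 2 * (s * φ s - Φ s) := by rw [c3]; ring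
      rw [c4]
      nlinarith
  rw [outerPrimitive]
  linarith

lemma hasDerivAt_outerPrimitive (h : IsPotential p φ Φ Ψ) (hp : -1 < p) {s : ℝ} (hs : 1 < s) :
    HasDerivAt (outerPrimitive p Φ Ψ) (radialKernel p φ s) s := by
  have a1 := (hasDerivAt_id s).add_const (1:ℝ)
  have a2 := (hasDerivAt_id s).sub_const (1:ℝ)
  have d1 := (h.hasDerivAt_snd (s + 1) (by linarith)).comp s a1
  have d2 := (h.hasDerivAt_snd (s - 1) (by linarith)).comp s a2
  have e1 := (h.hasDerivAt_trd (s + 1) (by linarith)).comp s a1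
  have e2 := (h.hasDerivAt_trd (s - 1) (by linarith)).comp s a2
  have d3 := ((Real.hasDerivAt_rpow_const (x := s) (p := p + 1)
    (Or.inl (by linarith))).const_mul 2).div_const (p + 1)
  refine ((((hasDerivAt_id s).mul (d1.sub d2)).sub (e1.sub e2)).sub d3).congr_deriv ?_
  rw [radialKernel, abs_sub_comm, abs_of_pos (by linarith : (0:ℝ) < s - 1), add_comm 1 s]
  have : p + 1 ≠ 0 := by linarith
  simp
  field_simp

lemma hasDerivAt_innerPrimitive (h : IsPotential p φ Φ Ψ) (hp : -1 < p) {s : ℝ} (hs0 : 0 < s)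
    (hs : s < 1) : HasDerivAt (innerPrimitive p Φ Ψ) (radialKernel p φ s) s := by
  have a1 := (hasDerivAt_id s).const_add (1:ℝ)
  have a2 := (hasDerivAt_id s).const_sub (1:ℝ)
  have d1 := (h.hasDerivAt_snd (1 + s) (by linarith)).comp s a1
  have d2 := (h.hasDerivAt_snd (1 - s) (by linarith)).comp s a2
  have e1 := (h.hasDerivAt_trd (1 + s) (by linarith)).comp s a1
  have e2 := (h.hasDerivAt_trd (1 - s) (by linarith)).comp s a2
  have d3 := ((Real.hasDerivAt_rpow_const (x := s) (p := p + 1)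
    (Or.inl (by linarith))).const_mul 2).div_const (p + 1)
  refine ((((hasDerivAt_id s).mul (d1.add d2)).sub (e1.sub e2)).sub d3).congr_deriv ?_
  rw [radialKernel, abs_of_pos (by linarith : (0:ℝ) < 1 - s)]
  have : p + 1 ≠ 0 := by linarith
  simp
  field_simp
  ring

lemma continuous_outerPrimitive (h : IsPotential p φ Φ Ψ) (hp : -1 < p) :
    Continuous (outerPrimitive p Φ Ψ) := by
  have h1 := h.continuous_snd
  have h2 := h.continuous_trd
  have h3 : Continuous fun s : ℝ => s ^ (p + 1) := Real.continuous_rpow_const (by linarith)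
  unfold outerPrimitive
  fun_prop

lemma continuous_innerPrimitive (h : IsPotential p φ Φ Ψ) (hp : -1 < p) :
    Continuous (innerPrimitive p Φ Ψ) := by
  have h1 := h.continuous_snd
  have h2 := h.continuous_trd
  have h3 : Continuous fun s : ℝ => s ^ (p + 1) := Real.continuous_rpow_const (by linarith)
  unfold innerPrimitive
  fun_prop

lemma integrableOn_radialKernel_Ioc (h : IsPotential p φ Φ Ψ) (hp : -1 < p) :
    IntegrableOn (radialKernel p φ) (Ioc 0 1) := by
  have hpow : IntegrableOn (fun s : ℝ => 2 * s ^ p) (Ioc 0 1) := by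
    have := (intervalIntegral.intervalIntegrable_rpow' (a := 0) (b := 1) hp).const_mul 2
    rwa [intervalIntegrable_iff_integrableOn_Ioc_of_le zero_le_one] at this
  have hcont : Continuous fun s : ℝ => innerPrimitive p Φ Ψ s + 2 * s ^ (p + 1) / (p + 1) := by
    have h3 : Continuous fun s : ℝ => s ^ (p + 1) := Real.continuous_rpow_const (by linarith)
    have := h.continuous_innerPrimitive hp
    fun_prop
  have hpos : IntegrableOn (fun s => radialKernel p φ s + 2 * s ^ p) (Ioc 0 1) := by
    refine intervalIntegral.integrableOn_deriv_of_nonneg hcont.continuousOn ?_ ?_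
    · rintro s ⟨h0, h1⟩
      have d3 := ((Real.hasDerivAt_rpow_const (x := s) (p := p + 1)
        (Or.inl (by linarith))).const_mul 2).div_const (p + 1)
      refine ((h.hasDerivAt_innerPrimitive hp h0 h1).add d3).congr_deriv ?_
      have : p + 1 ≠ 0 := by linarith
      simp
      field_simp
    · rintro s ⟨h0, h1⟩
      rw [radialKernel, abs_of_pos (by linarith : (0:ℝ) < 1 - s), sub_add_cancel]
      exact mul_nonneg h0.le (sub_nonneg.2
        (h.monotoneOn_fst (mem_Ioi.2 (by linarith)) (mem_Ioi.2 (by linarith)) (by linarith)))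
  exact (hpos.sub hpow).congr (Eventually.of_forall fun s => add_sub_cancel_right _ _)

lemma integrableOn_radialKernel_Ioc_one (h : IsPotential p φ Φ Ψ) (hp : -1 < p) (hp1 : p < 1)
    (b : ℝ) : IntegrableOn (radialKernel p φ) (Ioc 1 b) :=
  intervalIntegral.integrableOn_deriv_of_nonneg (h.continuous_outerPrimitive hp).continuousOn
    (fun _ hs => h.hasDerivAt_outerPrimitive hp hs.1)
    (fun _ hs => h.radialKernel_nonneg_of_one_lt hp1 hs.1)

lemma integral_radialKernel_one_le (h : IsPotential p φ Φ Ψ) (hp : -1 < p) (hp1 : p < 1)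
    {b : ℝ} (hb : 1 < b) :
    ∫ s in (1:ℝ)..b, radialKernel p φ s ≤ -outerPrimitive p Φ Ψ 1 := by
  rw [intervalIntegral.integral_eq_sub_of_hasDerivAt_of_le hb.le
    (h.continuous_outerPrimitive hp).continuousOn
    (fun s hs => h.hasDerivAt_outerPrimitive hp hs.1)
    ((intervalIntegrable_iff_integrableOn_Ioc_of_le hb.le).2
      (h.integrableOn_radialKernel_Ioc_one hp hp1 b))]
  linarith [h.outerPrimitive_nonpos hp1 hb]

lemma integrableOn_radialKernel_Ioi_one (h : IsPotential p φ Φ Ψ) (hp : -1 < p) (hp1 : p < 1) :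
    IntegrableOn (radialKernel p φ) (Ioi 1) := by
  refine integrableOn_Ioi_of_intervalIntegral_norm_bounded (-outerPrimitive p Φ Ψ 1) 1
    (h.integrableOn_radialKernel_Ioc_one hp hp1) tendsto_id ?_
  filter_upwards [eventually_gt_atTop 1] with b hb
  refine le_trans (le_of_eq ?_) (h.integral_radialKernel_one_le hp hp1 hb)
  refine intervalIntegral.integral_congr_ae (Eventually.of_forall fun s hs => ?_)
  rw [uIoc_of_le hb.le] at hs
  exact Real.norm_of_nonneg (h.radialKernel_nonneg_of_one_lt hp1 hs.1)

lemma integrableOn_radialKernel (h : IsPotential p φ Φ Ψ) (hp : -1 < p) (hp1 : p < 1) :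
    IntegrableOn (radialKernel p φ) (Ioi 0) := by
  rw [← Ioc_union_Ioi_eq_Ioi (zero_le_one (α := ℝ))]
  exact (h.integrableOn_radialKernel_Ioc hp).union (h.integrableOn_radialKernel_Ioi_one hp hp1)

lemma integral_radialKernel_nonpos (h : IsPotential p φ Φ Ψ) (hp : -1 < p) (hp1 : p < 1) :
    ∫ s in Ioi (0:ℝ), radialKernel p φ s ≤ 0 := by
  have hin := h.integrableOn_radialKernel_Ioc hp
  have hout := h.integrableOn_radialKernel_Ioi_one hp hp1
  rw [← Ioc_union_Ioi_eq_Ioi (zero_le_one (α := ℝ)),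
    setIntegral_union (Ioc_disjoint_Ioi le_rfl) measurableSet_Ioi hin hout,
    ← intervalIntegral.integral_of_le zero_le_one,
    intervalIntegral.integral_eq_sub_of_hasDerivAt_of_le zero_le_one
      (h.continuous_innerPrimitive hp).continuousOn
      (fun s hs => h.hasDerivAt_innerPrimitive hp hs.1 hs.2)
      ((intervalIntegrable_iff_integrableOn_Ioc_of_le zero_le_one).2 hin)]
  have hle : ∫ s in Ioi (1:ℝ), radialKernel p φ s ≤ -outerPrimitive p Φ Ψ 1 := by
    refine le_of_tendsto (intervalIntegral_tendsto_integral_Ioi 1 hout tendsto_id) ?_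
    filter_upwards [eventually_gt_atTop 1] with b hb
    exact h.integral_radialKernel_one_le hp hp1 hb
  have h0 : innerPrimitive p Φ Ψ 0 = 0 := by
    simp [innerPrimitive, Real.zero_rpow (by linarith : p + 1 ≠ 0)]
  have h1 : innerPrimitive p Φ Ψ 1 = outerPrimitive p Φ Ψ 1 := by
    simp [innerPrimitive, outerPrimitive, h.snd_zero]
  linarith

lemma radialKernel_nonneg_mono (h : IsPotential p φ Φ Ψ) (hp1 : p < 1) {s t : ℝ} (hs0 : 0 < s)
    (hst : s ≤ t) (ht : t < 1) (hs : 0 ≤ radialKernel p φ s) : 0 ≤ radialKernel p φ t := by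
  have factor : ∀ u, 0 < u → u < 1 →
      radialKernel p φ u = u ^ p * (u ^ (1 - p) * (φ (1 + u) - φ (1 - u)) - 2) := by
    intro u hu hu1
    have : u ^ p * u ^ (1 - p) = u := by
      rw [← Real.rpow_add hu]; simp
    rw [radialKernel, abs_of_pos (by linarith : (0:ℝ) < 1 - u), mul_sub (u ^ p), ← mul_assoc, this]
    ring
  have ht0 : 0 < t := hs0.trans_le hst
  rw [factor s hs0 (by linarith)] at hs
  rw [factor t ht0 ht]
  have hs' := nonneg_of_mul_nonneg_right hs (Real.rpow_pos_of_pos hs0 p)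
  refine mul_nonneg (Real.rpow_nonneg ht0.le p) (hs'.trans (sub_le_sub_right ?_ 2))
  have m1 := h.monotoneOn_fst (mem_Ioi.2 (by linarith : 0 < 1 + s))
    (mem_Ioi.2 (by linarith : 0 < 1 + t)) (by linarith)
  have m2 := h.monotoneOn_fst (mem_Ioi.2 (by linarith : 0 < 1 - t))
    (mem_Ioi.2 (by linarith : 0 < 1 - s)) (by linarith)
  have m3 := h.monotoneOn_fst (mem_Ioi.2 (by linarith : 0 < 1 - s))
    (mem_Ioi.2 (by linarith : 0 < 1 + s)) (by linarith)
  exact mul_le_mul (Real.rpow_le_rpow hs0.le hst (by linarith)) (by linarith) (by linarith)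
    (Real.rpow_nonneg ht0.le _)

/-- The radial kernel changes sign at most once, from negative to positive. -/
lemma exists_sign_change (h : IsPotential p φ Φ Ψ) (hp1 : p < 1) :
    ∃ s₀, 0 ≤ s₀ ∧ (∀ s, 0 < s → s < s₀ → radialKernel p φ s ≤ 0) ∧
      ∀ s, s₀ < s → s ≠ 1 → 0 ≤ radialKernel p φ s := by
  set A : Set ℝ := insert 1 {s | 0 < s ∧ s < 1 ∧ 0 ≤ radialKernel p φ s}
  have hpos : ∀ a ∈ A, 0 ≤ a := by
    rintro a (rfl | ⟨h0, -⟩)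
    · exact zero_le_one
    · exact h0.le
  have hbdd : BddBelow A := ⟨0, hpos⟩
  have h1A : (1:ℝ) ∈ A := mem_insert _ _
  refine ⟨sInf A, le_csInf ⟨1, h1A⟩ hpos, ?_, ?_⟩
  · intro s hs0 hs
    by_contra! hcon
    exact notMem_of_lt_csInf hs hbdd (Or.inr ⟨hs0, hs.trans_le (csInf_le hbdd h1A), hcon.le⟩)
  · intro s hs hs1
    obtain ⟨a, ha, has⟩ := exists_lt_of_csInf_lt ⟨1, h1A⟩ hs
    rcases lt_or_gt_of_ne hs1 with hlt | hgt
    · rcases ha with rfl | ⟨a0, -, ha⟩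
      · linarith
      · exact h.radialKernel_nonneg_mono hp1 a0 has.le hlt ha
    · exact h.radialKernel_nonneg_of_one_lt hp1 hgt

lemma integral_mul_radialKernel_nonpos (h : IsPotential p φ Φ Ψ) (hp : -1 < p) (hp1 : p < 1)
    {g : ℝ → ℝ} (hg : Continuous g) (hanti : AntitoneOn g (Ici 0)) (hg0 : ∀ s, 0 ≤ g s)
    (hg1 : ∀ s, g s ≤ 1) : ∫ s in Ioi (0:ℝ), g s * radialKernel p φ s ≤ 0 := by
  obtain ⟨s₀, hs₀, hneg, hpos⟩ := h.exists_sign_change hp1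
  have hint := h.integrableOn_radialKernel hp hp1
  have hle : ∫ s in Ioi (0:ℝ), g s * radialKernel p φ s
      ≤ ∫ s in Ioi (0:ℝ), g s₀ * radialKernel p φ s := by
    refine integral_mono_ae ?_ (hint.const_mul _) ?_
    · refine hint.bdd_mul (c := 1) hg.aestronglyMeasurable (Eventually.of_forall fun s => ?_)
      rw [Real.norm_of_nonneg (hg0 s)]
      exact hg1 s
    · have hne : ∀ᵐ s : ℝ, s ≠ 1 := Measure.ae_ne volume 1
      filter_upwards [ae_restrict_mem measurableSet_Ioi, ae_restrict_of_ae hne] with s hs hs1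
      rcases lt_trichotomy s s₀ with hlt | rfl | hgt
      · exact mul_le_mul_of_nonpos_right (hanti (mem_Ici.2 (le_of_lt hs)) hs₀ hlt.le) (hneg s hs hlt)
      · exact le_rfl
      · exact mul_le_mul_of_nonneg_right (hanti hs₀ (mem_Ici.2 (le_of_lt hs)) hgt.le) (hpos s hgt hs1)
  rw [integral_const_mul] at hle
  exact hle.trans (mul_nonpos_of_nonneg_of_nonpos (hg0 s₀) (h.integral_radialKernel_nonpos hp hp1))

end IsPotential

lemma isPotential_log : IsPotential 0 Real.log (fun u => u * Real.log u - u)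
    (fun u => u * (u * Real.log u) / 2 - 3 * u ^ 2 / 4) where
  hasDerivAt_fst u hu := by
    refine (Real.hasDerivAt_log hu.ne').congr_deriv ?_
    rw [zero_sub, Real.rpow_neg_one]
  hasDerivAt_snd u hu := by
    refine (((hasDerivAt_id u).mul (Real.hasDerivAt_log hu.ne')).sub (hasDerivAt_id u)).congr_deriv
      ?_
    simp [hu.ne']
  hasDerivAt_trd u hu := by
    refine ((((hasDerivAt_id u).mul ((hasDerivAt_id u).mul (Real.hasDerivAt_log hu.ne'))).div_const
      2).sub ((((hasDerivAt_id u).pow 2).const_mul 3).div_const 4)).congr_deriv ?_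
    simp [hu.ne']
    ring
  continuous_snd := by
    have := Real.continuous_mul_log
    fun_prop
  continuous_trd := by
    have := Real.continuous_mul_log
    fun_prop
  snd_zero := by simp
  euler u _ := by simp

lemma isPotential_rpow {p : ℝ} (hp : -1 < p) (hp0 : p ≠ 0) :
    IsPotential p (fun u => u ^ p / p) (fun u => u ^ (p + 1) / (p * (p + 1)))
      (fun u => u ^ (p + 2) / (p * (p + 1) * (p + 2))) where
  hasDerivAt_fst u hu := by
    refine ((Real.hasDerivAt_rpow_const (Or.inl hu.ne')).div_const p).congr_deriv ?_
    field_simp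
  hasDerivAt_snd u hu := by
    have : p + 1 ≠ 0 := by linarith
    refine ((Real.hasDerivAt_rpow_const (Or.inl hu.ne')).div_const _).congr_deriv ?_
    rw [add_sub_cancel_right]
    field_simp
  hasDerivAt_trd u hu := by
    have : p + 1 ≠ 0 := by linarith
    have : p + 2 ≠ 0 := by linarith
    refine ((Real.hasDerivAt_rpow_const (Or.inl hu.ne')).div_const _).congr_deriv ?_
    rw [show p + 2 - 1 = p + 1 by ring]
    field_simp
  continuous_snd := (Real.continuous_rpow_const (by linarith)).div_const _
  continuous_trd := (Real.continuous_rpow_const (by linarith)).div_const _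
  snd_zero := by simp [Real.zero_rpow (by linarith : p + 1 ≠ 0)]
  euler u hu := by
    have : p + 1 ≠ 0 := by linarith
    rw [Real.rpow_add_one hu.ne']
    field_simp
    ring

/-- The first potential attached to the exponent `p = 1 - 2α`. -/
def potential (α : ℝ) (u : ℝ) : ℝ :=
  if α = 1/2 then Real.log u else u ^ (1 - 2*α) / (1 - 2*α)

lemma exists_isPotential {α : ℝ} (hα : α < 1) :
    ∃ Φ Ψ : ℝ → ℝ, IsPotential (1 - 2*α) (potential α) Φ Ψ := by
  by_cases h : α = 1/2
  · rw [show potential α = Real.log from funext fun u => if_pos h,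
      show 1 - 2*α = 0 by rw [h]; norm_num]
    exact ⟨_, _, isPotential_log⟩
  · rw [show potential α = fun u => u ^ (1 - 2*α) / (1 - 2*α) from funext fun u => if_neg h]
    exact ⟨_, _, isPotential_rpow (by linarith) (fun h0 => h (by linarith))⟩

lemma TV_eq_integral_radialKernel {α : ℝ} (hα : α < 1) (f : ℝ → ℝ) (x : ℝ) :
    TV α f x = C1 α * |x| ^ (2 - 2*α) *
      ∫ s in Ioi (0:ℝ), f (|x| * s) * radialKernel (1 - 2*α) (potential α) s := by
  by_cases hx : x = 0
  · simp [TV, hx, Real.zero_rpow (by linarith : 2 - 2*α ≠ 0)]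
  have hy : 0 < |x| := abs_pos.2 hx
  rw [TV, if_neg hx]
  generalize |x| = y at hy
  have hne : ∀ᵐ s : ℝ, s ≠ 1 := Measure.ae_ne volume 1
  have scale : ∀ G : ℝ → ℝ, ∫ ξ in Ioi (0:ℝ), G ξ = y * ∫ s in Ioi (0:ℝ), G (y * s) := by
    intro G
    have := integral_comp_mul_left_Ioi' G 0 hy
    rw [mul_zero, smul_eq_mul] at this
    exact this.symm
  split_ifs with h
  · rw [scale, show 2 - 2*α = 1 by rw [h]; norm_num, Real.rpow_one, ← mul_assoc]
    congr 1
    refine integral_congr_ae ?_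
    filter_upwards [ae_restrict_mem measurableSet_Ioi, ae_restrict_of_ae hne] with s hs hs1
    have hs0 : 0 < s := hs
    have h1s : |1 - s| ≠ 0 := abs_ne_zero.2 (sub_ne_zero.2 hs1.symm)
    rw [show y + y * s = y * (1 + s) by ring, show y - y * s = y * (1 - s) by ring, abs_mul,
      abs_of_pos hy, mul_div_mul_left _ _ hy.ne', mul_div_cancel_left₀ _ hy.ne',
      Real.log_div (by linarith) h1s]
    simp [radialKernel, potential, h]
  · have hp : 1 - 2*α ≠ 0 := fun h0 => h (by linarith)
    rw [scale]
    have hcongr : ∫ s in Ioi (0:ℝ), f (y * s) * ((y * s / y) *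
          ((y + y * s) ^ (1 - 2*α) - |y - y * s| ^ (1 - 2*α))
          - 2 * (1 - 2*α) * (y * s) ^ (1 - 2*α))
        = ∫ s in Ioi (0:ℝ), ((1 - 2*α) * y ^ (1 - 2*α)) *
          (f (y * s) * radialKernel (1 - 2*α) (potential α) s) := by
      refine setIntegral_congr_fun measurableSet_Ioi fun s hs => ?_
      have hs0 : 0 < s := hs
      simp only [radialKernel, potential, if_neg h]
      rw [show y + y * s = y * (1 + s) by ring, show y - y * s = y * (1 - s) by ring, abs_mul,
        abs_of_pos hy, mul_div_cancel_left₀ _ hy.ne', Real.mul_rpow hy.le (by linarith),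
        Real.mul_rpow hy.le (abs_nonneg _), Real.mul_rpow hy.le hs0.le]
      field_simp
    rw [hcongr, integral_const_mul, show 2 - 2*α = (1 - 2*α) + 1 by ring,
      Real.rpow_add_one hy.ne']
    field_simp

/-! ### Basic properties of the invariant set -/

lemma C1_pos {α : ℝ} (hα : α ∈ Ioo (0:ℝ) 1) : 0 < C1 α := by
  have h1 : 0 < Real.Gamma (1/2 + α) := Real.Gamma_pos_of_pos (by linarith [hα.1])
  have h2 : 0 < Real.Gamma (1 - α) := Real.Gamma_pos_of_pos (by linarith [hα.2])
  unfold C1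
  positivity

lemma etaC_pos {α : ℝ} (hα : α ∈ Ioo (0:ℝ) 1) : 0 < etaC α := by
  have h1 : 0 < 3 - 2*α := by linarith [hα.2]
  have h2 : 0 < 5 - 2*α := by linarith [hα.2]
  unfold etaC
  positivity

lemma cV_factor_pos {α : ℝ} (hα : α ∈ Ioo (0:ℝ) 1) : 0 < 2*α*(1+2*α)/3 * C1 α := by
  have := C1_pos hα
  have := hα.1
  positivity

namespace V1

variable {α : ℝ} {f g : ℝ → ℝ}

lemma nonneg (hf : V1 α f) (x : ℝ) : 0 ≤ f x :=
  (le_max_left _ _).trans (hf.2.2.2.2.2.2.2.1 x)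

lemma one_sub_le_sq (hf : V1 α f) (x : ℝ) : 1 - f x ≤ x ^ 2 := by
  linarith [(le_max_right _ _).trans (hf.2.2.2.2.2.2.2.1 x)]

lemma continuous (hf : V1 α f) : Continuous f := hf.1

lemma antitoneOn (hf : V1 α f) : AntitoneOn f (Ici 0) := hf.2.2.2.2.2.1

lemma le_one (hf : V1 α f) (x : ℝ) : f x ≤ 1 := by
  have hx : f |x| = f x := by
    rcases abs_choice x with h | h <;> rw [h]
    exact hf.2.1 x
  rw [← hx, ← hf.2.2.2.1]
  exact hf.antitoneOn (mem_Ici.2 le_rfl) (mem_Ici.2 (abs_nonneg x)) (abs_nonneg x)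

lemma abs_sub_le_one (hf : V1 α f) (hg : V1 α g) (x : ℝ) : |f x - g x| ≤ 1 := by
  rw [abs_le]
  constructor <;> linarith [hf.nonneg x, hg.nonneg x, hf.le_one x, hg.le_one x]

lemma abs_sub_le_sq (hf : V1 α f) (hg : V1 α g) (x : ℝ) : |f x - g x| ≤ x ^ 2 := by
  rw [abs_le]
  constructor <;>
    linarith [hf.le_one x, hg.le_one x, hf.one_sub_le_sq x, hg.one_sub_le_sq x]

lemma exists_lt_one (hα : α ∈ Ioo (0:ℝ) 1) (hf : V1 α f) : ∃ y, 0 < y ∧ f y < 1 := by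
  by_contra! hcon
  have hone : ∀ y, 0 < y → f y = 1 := fun y hy => le_antisymm (hf.le_one y) (hcon y hy)
  obtain ⟨d, hd, hdη⟩ := hf.2.2.2.2.2.2.2.2
  have hev : f =ᶠ[nhds (1/2 : ℝ)] fun _ => 1 := by
    filter_upwards [lt_mem_nhds (by norm_num : (0:ℝ) < 1/2)] with y hy using hone y hy
  have h0 : HasDerivWithinAt f 0 (Iio (1/2 : ℝ)) (1/2) :=
    ((hasDerivAt_const (1/2 : ℝ) (1:ℝ)).congr_of_eventuallyEq hev).hasDerivWithinAt
  have : d = 0 := (uniqueDiffWithinAt_Iio (1/2 : ℝ)).eq_deriv _ hd h0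
  linarith [etaC_pos hα]

end V1

lemma integrableOn_min_one_sq_mul_rpow {α : ℝ} (hα : α ∈ Ioo (0:ℝ) 1) :
    IntegrableOn (fun ξ : ℝ => min 1 (ξ ^ 2) * ξ ^ (-1 - 2*α)) (Ioi 0) := by
  rw [← Ioc_union_Ioi_eq_Ioi (zero_le_one (α := ℝ))]
  refine IntegrableOn.union ?_ ?_
  · have h := intervalIntegral.intervalIntegrable_rpow' (a := 0) (b := 1) (r := 1 - 2*α)
      (by linarith [hα.2])
    rw [intervalIntegrable_iff_integrableOn_Ioc_of_le zero_le_one] at h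
    refine h.congr_fun (fun ξ hξ => ?_) measurableSet_Ioc
    have h1 : ξ ^ 2 ≤ 1 := pow_le_one₀ hξ.1.le hξ.2
    simp only
    rw [min_eq_right h1, ← Real.rpow_natCast ξ 2, ← Real.rpow_add hξ.1]
    congr 1
    push_cast
    ring
  · refine (integrableOn_Ioi_rpow_of_lt (a := -1 - 2*α) (by linarith [hα.1])
      zero_lt_one).congr_fun (fun ξ hξ => ?_) measurableSet_Ioi
    have h1 : 1 ≤ ξ ^ 2 := one_le_pow₀ (le_of_lt hξ)
    simp only
    rw [min_eq_left h1, one_mul]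

namespace V1

variable {α : ℝ} {f g : ℝ → ℝ}

lemma integrableOn_cV (hα : α ∈ Ioo (0:ℝ) 1) (hf : V1 α f) :
    IntegrableOn (fun ξ : ℝ => (1 - f ξ) * ξ ^ (-1 - 2*α)) (Ioi 0) := by
  refine (integrableOn_min_one_sq_mul_rpow hα).mono' ?_ ?_
  · refine (Measurable.mul ?_ ?_).aestronglyMeasurable
    · exact (continuous_const.sub hf.continuous).measurable
    · fun_prop
  · filter_upwards [ae_restrict_mem measurableSet_Ioi] with ξ hξ
    have hpow : 0 ≤ ξ ^ (-1 - 2*α) := Real.rpow_nonneg (le_of_lt hξ) _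
    rw [norm_mul, Real.norm_of_nonneg (sub_nonneg.2 (hf.le_one ξ)), Real.norm_of_nonneg hpow]
    exact mul_le_mul_of_nonneg_right
      (le_min (by linarith [hf.nonneg ξ]) (hf.one_sub_le_sq ξ)) hpow

lemma cV_pos (hα : α ∈ Ioo (0:ℝ) 1) (hf : V1 α f) : 0 < cV α f := by
  obtain ⟨y, hy, hfy⟩ := hf.exists_lt_one hα
  refine mul_pos (cV_factor_pos hα) ?_
  have hint := hf.integrableOn_cV hα
  have hnn : ∀ ξ ∈ Ioi (0:ℝ), 0 ≤ (1 - f ξ) * ξ ^ (-1 - 2*α) := fun ξ hξ =>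
    mul_nonneg (sub_nonneg.2 (hf.le_one ξ)) (Real.rpow_nonneg (le_of_lt hξ) _)
  have hexp : -1 - 2*α < -1 := by linarith [hα.1]
  have hsub : Ioi y ⊆ Ioi (0:ℝ) := Ioi_subset_Ioi hy.le
  calc 0 < (1 - f y) * (y ^ (-2*α) / (2*α)) := by
        have := hα.1
        have : 0 < 1 - f y := by linarith
        positivity
    _ = ∫ ξ in Ioi y, (1 - f y) * ξ ^ (-1 - 2*α) := by
        rw [integral_const_mul, integral_Ioi_rpow_of_lt hexp hy,
          show -1 - 2*α + 1 = -(2*α) by ring, neg_div_neg_eq, neg_mul]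
    _ ≤ ∫ ξ in Ioi y, (1 - f ξ) * ξ ^ (-1 - 2*α) := by
        refine setIntegral_mono_on ((integrableOn_Ioi_rpow_of_lt hexp hy).const_mul _)
          (hint.mono_set hsub) measurableSet_Ioi fun ξ hξ => ?_
        have hξ0 : 0 ≤ ξ := hy.le.trans (le_of_lt hξ)
        exact mul_le_mul_of_nonneg_right (sub_le_sub_left
          (hf.antitoneOn (mem_Ici.2 hy.le) (mem_Ici.2 hξ0) (le_of_lt hξ)) 1) (Real.rpow_nonneg hξ0 _)
    _ ≤ ∫ ξ in Ioi (0:ℝ), (1 - f ξ) * ξ ^ (-1 - 2*α) :=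
        setIntegral_mono_set hint (ae_restrict_of_forall_mem measurableSet_Ioi hnn)
          hsub.eventuallyLE

lemma integrableOn_mul_radialKernel (hα : α ∈ Ioo (0:ℝ) 1) (hf : V1 α f) (y : ℝ) :
    IntegrableOn (fun s => f (y * s) * radialKernel (1 - 2*α) (potential α) s) (Ioi 0) := by
  obtain ⟨Φ, Ψ, h⟩ := exists_isPotential hα.2
  have hint := h.integrableOn_radialKernel (by linarith [hα.2]) (by linarith [hα.1])
  refine hint.bdd_mul (c := 1)
    (hf.continuous.comp (continuous_const.mul continuous_id)).aestronglyMeasurable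
    (Eventually.of_forall fun s => ?_)
  rw [Real.norm_of_nonneg (hf.nonneg _)]
  exact hf.le_one _

lemma TV_nonpos (hα : α ∈ Ioo (0:ℝ) 1) (hf : V1 α f) (x : ℝ) : TV α f x ≤ 0 := by
  obtain ⟨Φ, Ψ, h⟩ := exists_isPotential hα.2
  rw [TV_eq_integral_radialKernel hα.2]
  refine mul_nonpos_of_nonneg_of_nonpos
    (mul_nonneg (C1_pos hα).le (Real.rpow_nonneg (abs_nonneg x) _)) ?_
  refine h.integral_mul_radialKernel_nonpos (by linarith [hα.2]) (by linarith [hα.1])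
    (g := fun s => f (|x| * s)) (hf.continuous.comp (continuous_const.mul continuous_id)) ?_
    (fun s => hf.nonneg _) (fun s => hf.le_one _)
  intro s hs t ht hst
  exact hf.antitoneOn (mul_nonneg (abs_nonneg x) hs) (mul_nonneg (abs_nonneg x) ht)
    (mul_le_mul_of_nonneg_left hst (abs_nonneg x))

lemma abs_TV_le (hα : α ∈ Ioo (0:ℝ) 1) (hf : V1 α f) {X x : ℝ} (hx : |x| ≤ X) :
    |TV α f x| ≤ C1 α * X ^ (2 - 2*α) *
      ∫ s in Ioi (0:ℝ), |radialKernel (1 - 2*α) (potential α) s| := by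
  obtain ⟨Φ, Ψ, h⟩ := exists_isPotential hα.2
  have hint := h.integrableOn_radialKernel (by linarith [hα.2]) (by linarith [hα.1])
  have hC := (C1_pos hα).le
  rw [TV_eq_integral_radialKernel hα.2, abs_mul,
    abs_of_nonneg (mul_nonneg hC (Real.rpow_nonneg (abs_nonneg x) _))]
  refine mul_le_mul (mul_le_mul_of_nonneg_left (Real.rpow_le_rpow (abs_nonneg x) hx
    (by linarith [hα.2])) hC) ?_ (abs_nonneg _)
    (mul_nonneg hC (Real.rpow_nonneg ((abs_nonneg x).trans hx) _))
  refine (abs_integral_le_integral_abs).trans (integral_mono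
    (hf.integrableOn_mul_radialKernel hα |x|).abs hint.abs fun s => ?_)
  simp only [abs_mul, abs_of_nonneg (hf.nonneg _)]
  exact mul_le_of_le_one_left (abs_nonneg _) (hf.le_one _)

lemma RV_mem_Icc (hα : α ∈ Ioo (0:ℝ) 1) (hf : V1 α f) (x : ℝ) : RV α f x ∈ Icc (0:ℝ) 1 := by
  refine ⟨le_max_left _ _, max_le zero_le_one ?_⟩
  linarith [div_nonpos_of_nonpos_of_nonneg (hf.TV_nonpos hα x) (hf.cV_pos hα).le]

end V1

/-! ### Continuity of the linear functionals -/

lemma tendsto_integral_min_one_mul {m q : ℝ → ℝ} (hm : IntegrableOn m (Ioi 0))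
    (hq : Measurable q) (hq0 : ∀ s ∈ Ioi (0:ℝ), 0 ≤ q s) :
    Tendsto (fun δ : ℝ => ∫ s in Ioi (0:ℝ), min 1 (δ * q s) * |m s|)
      (nhdsWithin 0 (Ioi 0)) (nhds 0) := by
  rw [show nhds (0:ℝ) = nhds (∫ s in Ioi (0:ℝ), min 1 (0 * q s) * |m s|) by simp]
  refine tendsto_integral_filter_of_dominated_convergence (fun s => |m s|) ?_ ?_ hm.abs ?_
  · refine Eventually.of_forall fun δ => ?_
    exact ((measurable_const.min (hq.const_mul δ)).aestronglyMeasurable).mul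
      hm.abs.aestronglyMeasurable
  · filter_upwards [self_mem_nhdsWithin] with δ hδ
    filter_upwards [ae_restrict_mem measurableSet_Ioi] with s hs
    have : 0 ≤ min 1 (δ * q s) := le_min zero_le_one (mul_nonneg (le_of_lt hδ) (hq0 s hs))
    rw [norm_mul, Real.norm_of_nonneg this, Real.norm_of_nonneg (abs_nonneg _)]
    exact mul_le_of_le_one_left (abs_nonneg _) (min_le_left _ _)
  · refine Eventually.of_forall fun s => tendsto_nhdsWithin_of_tendsto_nhds ?_
    have : Continuous fun δ : ℝ => min 1 (δ * q s) * |m s| := by fun_prop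
    exact this.tendsto 0

lemma exists_forall_abs_TV_sub_le {α : ℝ} (hα : α ∈ Ioo (0:ℝ) 1) {X ε : ℝ} (hX : 0 < X)
    (hε : 0 < ε) :
    ∃ δ > 0, ∀ f g : ℝ → ℝ, V1 α f → V1 α g → (∀ x, |f x - g x| ≤ δ * (1 + |x|) ^ α) →
      ∀ x, |x| ≤ X → |TV α f x - TV α g x| ≤ ε := by
  obtain ⟨Φ, Ψ, h⟩ := exists_isPotential hα.2
  have hint := h.integrableOn_radialKernel (by linarith [hα.2]) (by linarith [hα.1])
  set k := radialKernel (1 - 2*α) (potential α)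
  have hC : 0 < C1 α * X ^ (2 - 2*α) := mul_pos (C1_pos hα) (Real.rpow_pos_of_pos hX _)
  have hqm : Measurable fun s : ℝ => (1 + X * |s|) ^ α := by fun_prop
  have hq0 : ∀ s : ℝ, 0 ≤ (1 + X * |s|) ^ α := fun s => by positivity
  have htend := tendsto_integral_min_one_mul hint hqm (fun s _ => hq0 s)
  obtain ⟨δ, hδε, hδ⟩ := ((htend.eventually (gt_mem_nhds (div_pos hε hC))).and
    self_mem_nhdsWithin).exists
  have hδ0 : 0 < δ := hδ
  refine ⟨δ, hδ0, fun f g hf hg hfg x hx => ?_⟩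
  rw [TV_eq_integral_radialKernel hα.2, TV_eq_integral_radialKernel hα.2, ← mul_sub,
    ← integral_sub (hf.integrableOn_mul_radialKernel hα _) (hg.integrableOn_mul_radialKernel hα _),
    abs_mul, abs_of_nonneg (mul_nonneg (C1_pos hα).le (Real.rpow_nonneg (abs_nonneg x) _))]
  have hle : |∫ s in Ioi (0:ℝ), (f (|x| * s) * k s - g (|x| * s) * k s)|
      ≤ ∫ s in Ioi (0:ℝ), min 1 (δ * (1 + X * |s|) ^ α) * |k s| := by
    refine abs_integral_le_integral_abs.trans (integral_mono
      ((hf.integrableOn_mul_radialKernel hα |x|).sub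
        (hg.integrableOn_mul_radialKernel hα |x|)).abs ?_ fun s => ?_)
    · refine hint.abs.bdd_mul (c := 1)
        (measurable_const.min (hqm.const_mul δ)).aestronglyMeasurable
        (Eventually.of_forall fun s => ?_)
      rw [Real.norm_of_nonneg (le_min zero_le_one (mul_nonneg hδ0.le (hq0 s)))]
      exact min_le_left _ _
    · simp only [← sub_mul, abs_mul]
      refine mul_le_mul_of_nonneg_right (le_min (hf.abs_sub_le_one hg _) ((hfg _).trans ?_))
        (abs_nonneg _)
      refine mul_le_mul_of_nonneg_left (Real.rpow_le_rpow (by positivity) ?_ hα.1.le) hδ0.le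
      rw [abs_mul, abs_abs]
      linarith [mul_le_mul_of_nonneg_right hx (abs_nonneg s)]
  calc C1 α * |x| ^ (2 - 2*α) * |∫ s in Ioi (0:ℝ), (f (|x| * s) * k s - g (|x| * s) * k s)|
      ≤ C1 α * X ^ (2 - 2*α) * (ε / (C1 α * X ^ (2 - 2*α))) := by
        refine mul_le_mul (mul_le_mul_of_nonneg_left (Real.rpow_le_rpow (abs_nonneg x) hx
          (by linarith [hα.2])) (C1_pos hα).le) (hle.trans hδε.le) (abs_nonneg _) hC.le
    _ = ε := mul_div_cancel₀ _ hC.ne'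

lemma exists_forall_abs_cV_sub_le {α : ℝ} (hα : α ∈ Ioo (0:ℝ) 1) {ε : ℝ} (hε : 0 < ε) :
    ∃ δ > 0, ∀ f g : ℝ → ℝ, V1 α f → V1 α g → (∀ x, |f x - g x| ≤ δ * (1 + |x|) ^ α) →
      |cV α f - cV α g| ≤ ε := by
  have hC := cV_factor_pos hα
  have hint := integrableOn_min_one_sq_mul_rpow hα
  have hqm : Measurable fun ξ : ℝ => (1 + |ξ|) ^ α / min 1 (ξ ^ 2) := by fun_prop
  have hq0 : ∀ ξ : ℝ, 0 ≤ (1 + |ξ|) ^ α / min 1 (ξ ^ 2) := fun ξ => by positivity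
  have htend := tendsto_integral_min_one_mul hint hqm (fun s _ => hq0 s)
  obtain ⟨δ, hδε, hδ⟩ := ((htend.eventually (gt_mem_nhds (div_pos hε hC))).and
    self_mem_nhdsWithin).exists
  have hδ0 : 0 < δ := hδ
  refine ⟨δ, hδ0, fun f g hf hg hfg => ?_⟩
  rw [cV, cV, ← mul_sub, ← integral_sub (hf.integrableOn_cV hα) (hg.integrableOn_cV hα), abs_mul,
    abs_of_pos hC]
  refine (mul_le_mul_of_nonneg_left ?_ hC.le).trans (mul_div_cancel₀ ε hC.ne').le
  refine le_trans ?_ hδε.le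
  refine abs_integral_le_integral_abs.trans (setIntegral_mono_on
    ((hf.integrableOn_cV hα).sub (hg.integrableOn_cV hα)).abs ?_ measurableSet_Ioi fun ξ hξ => ?_)
  · refine hint.abs.bdd_mul (c := 1)
      (measurable_const.min (hqm.const_mul δ)).aestronglyMeasurable
      (Eventually.of_forall fun s => ?_)
    rw [Real.norm_of_nonneg (le_min zero_le_one (mul_nonneg hδ0.le (hq0 s)))]
    exact min_le_left _ _
  · have hξ0 : 0 < ξ := hξ
    have hm : 0 < min 1 (ξ ^ 2) := by positivity
    have hpow : 0 ≤ ξ ^ (-1 - 2*α) := Real.rpow_nonneg hξ0.le _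
    rw [← sub_mul, abs_mul, abs_mul, abs_of_nonneg hpow, abs_of_pos hm, ← mul_assoc,
      sub_sub_sub_cancel_left, abs_sub_comm]
    refine mul_le_mul_of_nonneg_right ?_ hpow
    rw [min_mul_of_nonneg _ _ hm.le, one_mul, mul_assoc, div_mul_cancel₀ _ hm.ne']
    exact le_min (le_min (hf.abs_sub_le_one hg ξ) (hf.abs_sub_le_sq hg ξ)) (hfg ξ)

lemma rho_eq_inv (α x : ℝ) : rho α x = ((1 + |x|) ^ α)⁻¹ :=
  Real.rpow_neg (by positivity) α

lemma rho_pos (α x : ℝ) : 0 < rho α x := Real.rpow_pos_of_pos (by positivity) _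

lemma rho_le_one {α : ℝ} (hα : 0 ≤ α) (x : ℝ) : rho α x ≤ 1 :=
  Real.rpow_le_one_of_one_le_of_nonpos (by linarith [abs_nonneg x]) (by linarith)

lemma V1.abs_sub_le_of_iSup_le {α δ : ℝ} (hα : 0 ≤ α) {f g : ℝ → ℝ} (hf : V1 α f) (hg : V1 α g)
    (h : (⨆ x : ℝ, rho α x * |f x - g x|) ≤ δ) (x : ℝ) : |f x - g x| ≤ δ * (1 + |x|) ^ α := by
  have hbdd : BddAbove (range fun x : ℝ => rho α x * |f x - g x|) := by
    refine ⟨1, ?_⟩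
    rintro _ ⟨y, rfl⟩
    exact mul_le_one₀ (rho_le_one hα y) (abs_nonneg _) (hf.abs_sub_le_one hg y)
  have hx := (le_ciSup hbdd x).trans h
  simp only [rho_eq_inv] at hx
  rwa [inv_mul_le_iff₀ (by positivity), mul_comm] at hx

lemma exists_forall_rho_le {α : ℝ} (hα : 0 < α) {ε : ℝ} (hε : 0 < ε) :
    ∃ X > 0, ∀ x, X ≤ |x| → rho α x ≤ ε := by
  have htend : Tendsto (fun y : ℝ => y ^ (-α)) atTop (nhds 0) := tendsto_rpow_neg_atTop hα
  obtain ⟨X, hX⟩ := eventually_atTop.1 (htend.eventually (gt_mem_nhds hε))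
  refine ⟨max X 1, by positivity, fun x hx => (hX (1 + |x|) ?_).le⟩
  linarith [le_max_left X 1]

lemma abs_div_sub_div_le {a a₀ c c₀ e B d : ℝ} (hc₀ : 0 < c₀) (hc : c₀ / 2 ≤ c)
    (ha : |a - a₀| ≤ e) (hB : |a₀| ≤ B) (hd : |c - c₀| ≤ d) :
    |a / c - a₀ / c₀| ≤ 2 * e / c₀ + 2 * B * d / c₀ ^ 2 := by
  have hcpos : 0 < c := by linarith
  have he : 0 ≤ e := (abs_nonneg _).trans ha
  have hB0 : 0 ≤ B := (abs_nonneg _).trans hB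
  have hinv : c⁻¹ ≤ 2 / c₀ := by
    rw [inv_le_comm₀ hcpos (by positivity), inv_div]
    exact hc
  have hsplit : a / c - a₀ / c₀ = (a - a₀) * c⁻¹ - a₀ * (c - c₀) * (c⁻¹ / c₀) := by
    field_simp
    ring
  have h1 : |(a - a₀) * c⁻¹| ≤ e * (2 / c₀) := by
    rw [abs_mul, abs_of_pos (inv_pos.2 hcpos)]
    exact mul_le_mul ha hinv (inv_pos.2 hcpos).le he
  have h2 : |a₀ * (c - c₀) * (c⁻¹ / c₀)| ≤ B * d * ((2 / c₀) / c₀) := by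
    have hpos : 0 < c⁻¹ / c₀ := by positivity
    rw [abs_mul, abs_mul, abs_of_pos hpos]
    exact mul_le_mul (mul_le_mul hB hd (abs_nonneg _) hB0)
      (div_le_div_of_nonneg_right hinv hc₀.le) hpos.le
      (mul_nonneg hB0 ((abs_nonneg _).trans hd))
  calc |a / c - a₀ / c₀| ≤ e * (2 / c₀) + B * d * ((2 / c₀) / c₀) := by
        rw [hsplit]
        exact (abs_sub _ _).trans (add_le_add h1 h2)
    _ = 2 * e / c₀ + 2 * B * d / c₀ ^ 2 := by field_simp

/-- For every `α ∈ (0,1)`, the map `ℛ_α : 𝒱₁ → 𝒱₁` is continuous with respect to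
the weighted uniform metric `d(f,g) = sup_x ρ(x)|f(x)-g(x)|`. -/
theorem RV_continuous (α : ℝ) (hα : α ∈ Ioo (0:ℝ) 1) (f₀ : ℝ → ℝ) (hf₀ : V1 α f₀)
    (ε : ℝ) (hε : 0 < ε) :
    ∃ δ : ℝ, 0 < δ ∧ ∀ f : ℝ → ℝ, V1 α f →
      (⨆ x : ℝ, rho α x * |f x - f₀ x|) ≤ δ →
      (⨆ x : ℝ, rho α x * |RV α f x - RV α f₀ x|) ≤ ε := by
  obtain ⟨X, hX, hrho⟩ := exists_forall_rho_le hα.1 hε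
  set c₀ := cV α f₀
  have hc₀ : 0 < c₀ := hf₀.cV_pos hα
  set B := C1 α * X ^ (2 - 2*α) * ∫ s in Ioi (0:ℝ), |radialKernel (1 - 2*α) (potential α) s|
  have hB : 0 ≤ B := mul_nonneg (mul_nonneg (C1_pos hα).le (Real.rpow_nonneg hX.le _))
    (integral_nonneg fun _ => abs_nonneg _)
  obtain ⟨δ₁, hδ₁, hT⟩ := exists_forall_abs_TV_sub_le hα hX (ε := ε * c₀ / 4) (by positivity)
  set e := min (c₀ / 2) (ε * c₀ ^ 2 / (4 * (B + 1)))
  obtain ⟨δ₂, hδ₂, hc⟩ := exists_forall_abs_cV_sub_le hα (ε := e) (by positivity)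
  refine ⟨min δ₁ δ₂, lt_min hδ₁ hδ₂, fun f hf hsup => ciSup_le fun x => ?_⟩
  rcases le_total X |x| with hx | hx
  · refine (mul_le_mul (hrho x hx) ?_ (abs_nonneg _) hε.le).trans (mul_one ε).le
    have h1 := hf.RV_mem_Icc hα x
    have h2 := hf₀.RV_mem_Icc hα x
    rw [abs_le]
    constructor <;> linarith [h1.1, h1.2, h2.1, h2.2]
  · have hT' := hT f f₀ hf hf₀
      (hf.abs_sub_le_of_iSup_le hα.1.le hf₀ (hsup.trans (min_le_left _ _))) x hx
    have hc' := hc f f₀ hf hf₀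
      (hf.abs_sub_le_of_iSup_le hα.1.le hf₀ (hsup.trans (min_le_right _ _)))
    have hcf : c₀ / 2 ≤ cV α f := by
      linarith [(abs_le.1 (hc'.trans (min_le_left _ _))).1]
    have hmain := abs_div_sub_div_le hc₀ hcf hT' (hf₀.abs_TV_le hα hx) hc'
    have hRV : |RV α f x - RV α f₀ x| ≤ |TV α f x / cV α f - TV α f₀ x / c₀| := by
      refine (abs_max_sub_max_le_max _ _ _ _).trans ?_
      simp [c₀]
    have h1 : 2 * (ε * c₀ / 4) / c₀ = ε / 2 := by field_simp; norm_num
    have h2 : 2 * B * e / c₀ ^ 2 ≤ ε / 2 := by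
      have hle : B * e ≤ (B + 1) * (ε * c₀ ^ 2 / (4 * (B + 1))) :=
        mul_le_mul (by linarith) (min_le_right _ _) (by positivity) (by positivity)
      have heq : (B + 1) * (ε * c₀ ^ 2 / (4 * (B + 1))) = ε * c₀ ^ 2 / 4 := by field_simp
      rw [div_le_iff₀ (by positivity)]
      linarith
    calc rho α x * |RV α f x - RV α f₀ x| ≤ 1 * |RV α f x - RV α f₀ x| :=
          mul_le_mul_of_nonneg_right (rho_le_one hα.1.le x) (abs_nonneg _)
      _ ≤ ε := by linarith

end GSQGplane
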